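/- Let a : SU(1,1) → ℂ be continuous and compactly supported with a(−g) = a(g) for all g. Let b ≠ b' be points of S¹, let g₀ be an oriented-geodesic frame for (b', b), let r, r' ∈ ℝ, and let A : 𝔻 → ℂ satisfy A(g·0) = a(g) for every g ∈ SU(1,1) with g·1 = b. Then both integrals below converge absolutely and |b−b'|^{−(1+i(r+r'))} · ∫_ℝ ∫_ℝ a(g₀ · A_τ · N_u) (1+u²)^{−(1/2+ir')} e^{i(r−r')τ} du dτ = 2^{−(1+i(r+r'))} · ∫_𝔻 A(z) · P(z,b)^{1/2+ir} · P(z,b')^{1/2+ir'} Vol(dz); that is, the Patterson–Sullivan distribution PS_{(ir,b),(−ir',b')} applied to the horocyclic average L_{ir'}a equals 2^{−(1+i(r+r'))} times the Wigner distribution W_{(ir,b),(−ir',b')} applied to a. -/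

import Mathlib

open Complex MeasureTheory Real

noncomputable section

/-- Möbius action of a 2×2 complex matrix on ℂ. -/
def moeb (g : Matrix (Fin 2) (Fin 2) ℂ) (w : ℂ) : ℂ :=
  (g 0 0 * w + g 0 1) / (g 1 0 * w + g 1 1)

/-- The predicate defining SU(1,1) matrices. -/
def IsSU11 (g : Matrix (Fin 2) (Fin 2) ℂ) : Prop :=
  g 1 0 = (starRingEnd ℂ) (g 0 1) ∧ g 1 1 = (starRingEnd ℂ) (g 0 0) ∧
    ‖g 0 0‖ ^ 2 - ‖g 0 1‖ ^ 2 = 1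

/-- The geodesic-flow one-parameter subgroup of SU(1,1). -/
def Amat (τ : ℝ) : Matrix (Fin 2) (Fin 2) ℂ :=
  !![(Real.cosh (τ / 2) : ℂ), (Real.sinh (τ / 2) : ℂ);
     (Real.sinh (τ / 2) : ℂ), (Real.cosh (τ / 2) : ℂ)]

/-- The horocycle-flow one-parameter subgroup of SU(1,1). -/
def Nmat (u : ℝ) : Matrix (Fin 2) (Fin 2) ℂ :=
  !![1 + (u : ℂ) * Complex.I / 2, -((u : ℂ) * Complex.I) / 2;
     (u : ℂ) * Complex.I / 2, 1 - (u : ℂ) * Complex.I / 2]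

/-- Poisson kernel on 𝔻 × S¹. -/
def Pk (z b : ℂ) : ℝ := (1 - ‖z‖ ^ 2) / ‖z - b‖ ^ 2

/-- Hyperbolic area measure on the unit disc 𝔻. -/
def hypVol : Measure ℂ :=
  (volume.restrict (Metric.ball (0 : ℂ) 1)).withDensity
    (fun z => ENNReal.ofReal (4 / (1 - ‖z‖ ^ 2) ^ 2))

/-- `g₀` is an oriented-geodesic frame for the pair of boundary points `(b', b)`. -/
def frameFor (g₀ : Matrix (Fin 2) (Fin 2) ℂ) (b' b : ℂ) : Prop :=
  IsSU11 g₀ ∧ moeb g₀ 1 = b ∧ moeb g₀ (-1) = b' ∧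
    ‖moeb g₀ 0 - b‖ = ‖moeb g₀ 0 - b'‖

open scoped ComplexConjugate

/-- The determinant of a real-linear endomorphism of `ℂ` in the basis `1, I`. -/
theorem det_real_endomorphism_complex (M : ℂ →L[ℝ] ℂ) :
    M.det = (M 1).re * (M Complex.I).im - (M 1).im * (M Complex.I).re := by
  rw [ContinuousLinearMap.det, ← LinearMap.det_toMatrix Complex.basisOneI, Matrix.det_fin_two]
  simp [LinearMap.toMatrix_apply]
  ring

/-- Complex powers of a positive real base through the real logarithm. -/
theorem cpow_eq_exp_log {x : ℝ} (hx : 0 < x) (c : ℂ) :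
    (x : ℂ) ^ c = Complex.exp ((Real.log x : ℂ) * c) := by
  rw [Complex.cpow_def_of_ne_zero (by exact_mod_cast hx.ne'), Complex.ofReal_log hx.le]

/-- The right half-plane point with horocyclic coordinates `τ = re z`, `u = im z`. -/
def halfPlanePoint (z : ℂ) : ℂ := (Real.exp z.re : ℂ) * (1 - (z.im : ℂ) * Complex.I)

/-- The Möbius map from the right half-plane to the disc attached to the frame
`[[α, β], [conj β, conj α]]`, with `p = α + β` and `q = α - β`. -/
def discPoint (p q s : ℂ) : ℂ := (p * s - q) / (conj p * s + conj q)

theorem halfPlanePoint_re (z : ℂ) : (halfPlanePoint z).re = Real.exp z.re := by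
  simp [halfPlanePoint, Complex.exp_ofReal_re]

theorem halfPlanePoint_im (z : ℂ) : (halfPlanePoint z).im = -(Real.exp z.re * z.im) := by
  simp [halfPlanePoint, -Complex.ofReal_exp]

theorem halfPlanePoint_injective : Function.Injective halfPlanePoint := by
  intro z w h
  have h1 := congrArg Complex.re h
  have h2 := congrArg Complex.im h
  rw [halfPlanePoint_re, halfPlanePoint_re] at h1
  rw [halfPlanePoint_im, halfPlanePoint_im, h1] at h2
  refine Complex.ext (Real.exp_injective h1) ?_
  exact mul_left_cancel₀ (Real.exp_pos w.re).ne' (neg_injective h2)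

theorem exists_halfPlanePoint {s : ℂ} (hs : 0 < s.re) : ∃ z, halfPlanePoint z = s := by
  refine ⟨⟨Real.log s.re, -(s.im / s.re)⟩, Complex.ext ?_ ?_⟩
  · rw [halfPlanePoint_re, Real.exp_log hs]
  · rw [halfPlanePoint_im, Real.exp_log hs]
    field_simp

theorem normSq_halfPlanePoint (z : ℂ) :
    ‖halfPlanePoint z‖ ^ 2 = Real.exp z.re ^ 2 * (1 + z.im ^ 2) := by
  rw [Complex.sq_norm, Complex.normSq_apply, halfPlanePoint_re, halfPlanePoint_im]
  ring

theorem exists_hasFDerivAt_halfPlanePoint (z : ℂ) :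
    ∃ L : ℂ →L[ℝ] ℂ, HasFDerivAt halfPlanePoint L z ∧ L 1 = halfPlanePoint z ∧
      L Complex.I = -(Real.exp z.re : ℂ) * Complex.I := by
  have h1 : HasFDerivAt (fun z : ℂ => (Real.exp z.re : ℂ)) _ z :=
    Complex.ofRealCLM.hasFDerivAt.comp z (Complex.reCLM.hasFDerivAt.exp)
  have h2 : HasFDerivAt (fun z : ℂ => (z.im : ℂ)) _ z :=
    Complex.ofRealCLM.hasFDerivAt.comp z Complex.imCLM.hasFDerivAt
  refine ⟨_, h1.mul ((h2.mul_const Complex.I).const_sub 1), ?_, ?_⟩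
  · simp [halfPlanePoint]
    ring
  · simp

section DiscPoint

variable {p q s : ℂ}

theorem den_normSq_sub_num_normSq (hpq : p * conj q + conj p * q = 2) (s : ℂ) :
    ‖conj p * s + conj q‖ ^ 2 - ‖p * s - q‖ ^ 2 = 4 * s.re := by
  have h : ((‖conj p * s + conj q‖ ^ 2 - ‖p * s - q‖ ^ 2 : ℝ) : ℂ) = ((4 * s.re : ℝ) : ℂ) := by
    have hs : s + conj s = 2 * (s.re : ℂ) := by
      rw [Complex.add_conj]; push_cast; ring
    push_cast
    rw [← Complex.mul_conj', ← Complex.mul_conj']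
    simp only [map_add, map_sub, map_mul, Complex.conj_conj]
    linear_combination (s + conj s) * hpq + 2 * hs
  exact_mod_cast h

theorem den_ne_zero (hpq : p * conj q + conj p * q = 2) (hs : 0 < s.re) :
    conj p * s + conj q ≠ 0 := by
  intro h
  have := den_normSq_sub_num_normSq hpq s
  rw [h, norm_zero] at this
  nlinarith [sq_nonneg ‖p * s - q‖]

theorem one_sub_normSq_discPoint (hpq : p * conj q + conj p * q = 2)
    (hD : conj p * s + conj q ≠ 0) :
    1 - ‖discPoint p q s‖ ^ 2 = 4 * s.re / ‖conj p * s + conj q‖ ^ 2 := by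
  have hn : ‖conj p * s + conj q‖ ≠ 0 := norm_ne_zero_iff.2 hD
  rw [← den_normSq_sub_num_normSq hpq s, discPoint, norm_div, div_pow, sub_div,
    div_self (pow_ne_zero 2 hn)]

theorem left_ne_zero (hpq : p * conj q + conj p * q = 2) : p ≠ 0 := by
  rintro rfl; simp at hpq

theorem right_ne_zero (hpq : p * conj q + conj p * q = 2) : q ≠ 0 := by
  rintro rfl; simp at hpq

theorem Pk_discPoint_forward (hpq : p * conj q + conj p * q = 2) (hs : 0 < s.re) :
    Pk (discPoint p q s) (p / conj p) = s.re * ‖p‖ ^ 2 := by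
  have hD := den_ne_zero hpq hs
  have hp := left_ne_zero hpq
  have hp' : conj p ≠ 0 := by simpa using hp
  have hsub : discPoint p q s - p / conj p = -2 / ((conj p * s + conj q) * conj p) := by
    rw [discPoint, div_sub_div _ _ hD hp']
    congr 1
    linear_combination -hpq
  rw [Pk, one_sub_normSq_discPoint hpq hD, hsub, norm_div, norm_mul, norm_neg, Complex.norm_conj]
  have h1 : ‖conj p * s + conj q‖ ≠ 0 := norm_ne_zero_iff.2 hD
  have h2 : ‖p‖ ≠ 0 := norm_ne_zero_iff.2 hp
  simp only [Complex.norm_ofNat]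
  field_simp
  ring

theorem Pk_discPoint_backward (hpq : p * conj q + conj p * q = 2) (hs : 0 < s.re) :
    Pk (discPoint p q s) (-q / conj q) = s.re * ‖q‖ ^ 2 / ‖s‖ ^ 2 := by
  have hD := den_ne_zero hpq hs
  have hq := right_ne_zero hpq
  have hq' : conj q ≠ 0 := by simpa using hq
  have hs0 : s ≠ 0 := by rintro rfl; simp at hs
  have hsub : discPoint p q s - -q / conj q = 2 * s / ((conj p * s + conj q) * conj q) := by
    rw [discPoint, div_sub_div _ _ hD hq']
    congr 1
    linear_combination s * hpq
  rw [Pk, one_sub_normSq_discPoint hpq hD, hsub, norm_div, norm_mul, norm_mul, Complex.norm_conj]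
  have h1 : ‖conj p * s + conj q‖ ≠ 0 := norm_ne_zero_iff.2 hD
  have h2 : ‖q‖ ≠ 0 := norm_ne_zero_iff.2 hq
  have h3 : ‖s‖ ≠ 0 := norm_ne_zero_iff.2 hs0
  simp only [Complex.norm_ofNat]
  field_simp
  ring

theorem hasDerivAt_discPoint (hpq : p * conj q + conj p * q = 2) (hs : 0 < s.re) :
    HasDerivAt (discPoint p q) (2 / (conj p * s + conj q) ^ 2) s := by
  have hD := den_ne_zero hpq hs
  have h := ((((hasDerivAt_id s).const_mul p).sub_const q).div
    (((hasDerivAt_id s).const_mul (conj p)).add_const (conj q)) hD)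
  refine h.congr_deriv ?_
  congr 1
  simp only [id]
  linear_combination hpq

theorem discPoint_injOn (hpq : p * conj q + conj p * q = 2) :
    Set.InjOn (discPoint p q) {s | 0 < s.re} := by
  intro s hs t ht h
  have hDs := den_ne_zero hpq hs
  have hDt := den_ne_zero hpq ht
  rw [discPoint, discPoint, div_eq_div_iff hDs hDt] at h
  linear_combination h / 2 - (s - t) / 2 * hpq

theorem exists_discPoint (hpq : p * conj q + conj p * q = 2) {w : ℂ} (hw : ‖w‖ < 1) :
    ∃ s, 0 < s.re ∧ discPoint p q s = w := by
  have hp := left_ne_zero hpq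
  have hE : p - w * conj p ≠ 0 := by
    intro h
    have h1 : ‖p‖ = ‖w‖ * ‖p‖ := by
      rw [← Complex.norm_conj p, ← norm_mul, Complex.norm_conj, ← sub_eq_zero.1 h]
    nlinarith [norm_pos_iff.2 hp]
  have hD : conj p * ((q + w * conj q) / (p - w * conj p)) + conj q ≠ 0 := by
    have : conj p * ((q + w * conj q) / (p - w * conj p)) + conj q = 2 / (p - w * conj p) := by
      rw [← mul_div_assoc, div_add' _ _ _ hE]
      congr 1
      linear_combination hpq
    rw [this]
    exact div_ne_zero two_ne_zero hE
  have hval : discPoint p q ((q + w * conj q) / (p - w * conj p)) = w := by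
    rw [discPoint, div_eq_iff hD]
    field_simp
    ring
  refine ⟨_, ?_, hval⟩
  have h := one_sub_normSq_discPoint hpq hD
  rw [hval] at h
  have hpos : 0 < ‖conj p * ((q + w * conj q) / (p - w * conj p)) + conj q‖ ^ 2 :=
    pow_pos (norm_pos_iff.2 hD) 2
  have hw2 : 0 < 1 - ‖w‖ ^ 2 := by nlinarith [norm_nonneg w]
  rw [h, div_pos_iff_of_pos_right hpos] at hw2
  linarith

/-- The Jacobian of the horocyclic coordinates `τ + i u ↦ discPoint p q (halfPlanePoint (τ + i u))`
on the disc is the inverse of the hyperbolic density. -/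
theorem exists_hasFDerivAt_horocyclic (hpq : p * conj q + conj p * q = 2) (z : ℂ) :
    ∃ L : ℂ →L[ℝ] ℂ, HasFDerivAt (fun z => discPoint p q (halfPlanePoint z)) L z ∧
      |L.det| * (4 / (1 - ‖discPoint p q (halfPlanePoint z)‖ ^ 2) ^ 2) = 1 := by
  have hs : 0 < (halfPlanePoint z).re := by rw [halfPlanePoint_re]; exact Real.exp_pos _
  have hD := den_ne_zero hpq hs
  obtain ⟨L, hL, hL1, hLI⟩ := exists_hasFDerivAt_halfPlanePoint z
  refine ⟨_, (hasDerivAt_discPoint hpq hs).complexToReal_fderiv.comp z hL, ?_⟩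
  rw [one_sub_normSq_discPoint hpq hD]
  set D := conj p * halfPlanePoint z + conj q with hDdef
  set m : ℂ := 2 / D ^ 2 with hm
  have hdet : ((m • (1 : ℂ →L[ℝ] ℂ)).comp L).det = -(‖m‖ ^ 2 * Real.exp z.re ^ 2) := by
    rw [det_real_endomorphism_complex, Complex.sq_norm, Complex.normSq_apply]
    simp only [ContinuousLinearMap.comp_apply, hL1, hLI, smul_apply,
      one_apply_eq_self, smul_eq_mul, Complex.mul_re, Complex.mul_im, Complex.neg_re,
      Complex.neg_im, Complex.I_re, Complex.I_im, Complex.ofReal_re, Complex.ofReal_im,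
      halfPlanePoint_re, halfPlanePoint_im]
    ring
  have h1 : ‖D‖ ≠ 0 := norm_ne_zero_iff.2 hD
  have he := Real.exp_pos z.re
  rw [hdet, abs_neg, abs_of_nonneg (by positivity), halfPlanePoint_re, hm, norm_div, norm_pow,
    Complex.norm_ofNat]
  field_simp
  norm_num

end DiscPoint

section ChangeOfVariables

variable {p q : ℂ}

theorem horocyclic_injective (hpq : p * conj q + conj p * q = 2) :
    Function.Injective fun z => discPoint p q (halfPlanePoint z) := by
  intro z w h
  refine halfPlanePoint_injective (discPoint_injOn hpq ?_ ?_ h) <;>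
  · rw [Set.mem_ofPred_eq, halfPlanePoint_re]
    exact Real.exp_pos _

theorem image_horocyclic (hpq : p * conj q + conj p * q = 2) :
    (fun z => discPoint p q (halfPlanePoint z)) '' Set.univ = Metric.ball 0 1 := by
  ext w
  rw [Set.image_univ, Set.mem_range, mem_ball_zero_iff]
  constructor
  · rintro ⟨z, rfl⟩
    have hs : 0 < (halfPlanePoint z).re := by rw [halfPlanePoint_re]; exact Real.exp_pos _
    have hD := den_ne_zero hpq hs
    have h := one_sub_normSq_discPoint hpq hD
    have hpos : 0 < 4 * (halfPlanePoint z).re / ‖conj p * halfPlanePoint z + conj q‖ ^ 2 :=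
      div_pos (by linarith) (pow_pos (norm_pos_iff.2 hD) 2)
    rw [← h] at hpos
    nlinarith [norm_nonneg (discPoint p q (halfPlanePoint z))]
  · intro hw
    obtain ⟨s, hs, rfl⟩ := exists_discPoint hpq hw
    obtain ⟨z, rfl⟩ := exists_halfPlanePoint hs
    exact ⟨z, rfl⟩

theorem measurable_hypVol_density :
    Measurable fun z : ℂ => ENNReal.ofReal (4 / (1 - ‖z‖ ^ 2) ^ 2) := by
  fun_prop

/-- Hyperbolic area is Lebesgue measure in horocyclic coordinates. -/
theorem hypVol_horocyclic (hpq : p * conj q + conj p * q = 2) (W : ℂ → ℂ) :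
    (Integrable W hypVol ↔
      Integrable fun x : ℝ × ℝ => W (discPoint p q (halfPlanePoint ⟨x.1, x.2⟩))) ∧
    ∫ z, W z ∂hypVol = ∫ x : ℝ × ℝ, W (discPoint p q (halfPlanePoint ⟨x.1, x.2⟩)) := by
  choose L hL hdet using fun z => exists_hasFDerivAt_horocyclic hpq z
  have hfin : ∀ᵐ z ∂(volume.restrict (Metric.ball (0 : ℂ) 1)),
      ENNReal.ofReal (4 / (1 - ‖z‖ ^ 2) ^ 2) < ⊤ := .of_forall fun _ => ENNReal.ofReal_lt_top
  have hsmul : ∀ z, |(L z).det| • ((ENNReal.ofReal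
      (4 / (1 - ‖discPoint p q (halfPlanePoint z)‖ ^ 2) ^ 2)).toReal •
        W (discPoint p q (halfPlanePoint z))) = W (discPoint p q (halfPlanePoint z)) := by
    intro z
    rw [ENNReal.toReal_ofReal (by positivity), smul_smul, hdet, one_smul]
  have hcoord : ∀ z : ℂ, W (discPoint p q (halfPlanePoint z)) =
      (fun x : ℝ × ℝ => W (discPoint p q (halfPlanePoint ⟨x.1, x.2⟩)))
        (Complex.measurableEquivRealProd z) := fun z => rfl
  have hemb := Complex.measurableEquivRealProd.measurableEmbedding
  have hmp := Complex.volume_preserving_equiv_real_prod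
  have hL' : ∀ z ∈ Set.univ, HasFDerivWithinAt
      (fun z => discPoint p q (halfPlanePoint z)) (L z) Set.univ z :=
    fun z _ => (hL z).hasFDerivWithinAt
  have hinj := (horocyclic_injective hpq).injOn (s := Set.univ)
  constructor
  · rw [hypVol, integrable_withDensity_iff_integrable_smul' measurable_hypVol_density hfin,
      ← IntegrableOn, ← image_horocyclic hpq,
      integrableOn_image_iff_integrableOn_abs_det_fderiv_smul volume MeasurableSet.univ hL' hinj,
      integrableOn_univ]
    simp only [hsmul]
    exact hmp.integrable_comp_emb hemb
      (g := fun x : ℝ × ℝ => W (discPoint p q (halfPlanePoint ⟨x.1, x.2⟩)))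
  · rw [hypVol, integral_withDensity_eq_integral_toReal_smul measurable_hypVol_density hfin,
      ← image_horocyclic hpq,
      integral_image_eq_integral_abs_det_fderiv_smul volume MeasurableSet.univ hL' hinj,
      setIntegral_univ]
    simp only [hsmul]
    exact hmp.integral_comp hemb
      (fun x : ℝ × ℝ => W (discPoint p q (halfPlanePoint ⟨x.1, x.2⟩)))

end ChangeOfVariables

section Frames

variable {g h : Matrix (Fin 2) (Fin 2) ℂ}

theorem isSU11_iff : IsSU11 g ↔ g 1 0 = conj (g 0 1) ∧ g 1 1 = conj (g 0 0) ∧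
    g 0 0 * conj (g 0 0) - g 0 1 * conj (g 0 1) = 1 := by
  rw [IsSU11, Complex.mul_conj', Complex.mul_conj']
  norm_cast

theorem IsSU11.mul (hg : IsSU11 g) (hh : IsSU11 h) : IsSU11 (g * h) := by
  rw [isSU11_iff] at *
  obtain ⟨h1, h2, h3⟩ := hg
  obtain ⟨k1, k2, k3⟩ := hh
  simp only [Matrix.mul_apply, Fin.sum_univ_two, h1, h2, k1, k2, map_add, map_mul,
    Complex.conj_conj]
  refine ⟨by ring, by ring, ?_⟩
  linear_combination (h 0 0 * conj (h 0 0) - h 0 1 * conj (h 0 1)) * h3 + k3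

theorem isSU11_Amat (τ : ℝ) : IsSU11 (Amat τ) := by
  rw [isSU11_iff]
  simp only [Amat, Matrix.of_apply, Matrix.cons_val', Matrix.cons_val_zero, Matrix.cons_val_one,
    Matrix.cons_val_fin_one, Complex.conj_ofReal, true_and]
  norm_cast
  linear_combination Real.cosh_sq (τ / 2)

theorem isSU11_Nmat (u : ℝ) : IsSU11 (Nmat u) := by
  rw [isSU11_iff]
  simp only [Nmat, Matrix.of_apply, Matrix.cons_val', Matrix.cons_val_zero, Matrix.cons_val_one,
    Matrix.cons_val_fin_one, map_add, map_neg, map_mul, map_div₀, Complex.conj_ofReal,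
    Complex.conj_I, map_one, map_ofNat]
  refine ⟨by ring, by ring, ?_⟩
  ring

theorem IsSU11.row_relation (hg : IsSU11 g) :
    (g 0 0 + g 0 1) * conj (g 0 0 - g 0 1) + conj (g 0 0 + g 0 1) * (g 0 0 - g 0 1) = 2 := by
  have h := (isSU11_iff.1 hg).2.2
  simp only [map_add, map_sub]
  linear_combination 2 * h

theorem IsSU11.moeb_one (hg : IsSU11 g) :
    moeb g 1 = (g 0 0 + g 0 1) / conj (g 0 0 + g 0 1) := by
  rw [moeb, hg.1, hg.2.1, map_add, mul_one, mul_one, add_comm (conj (g 0 1))]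

theorem IsSU11.moeb_neg_one (hg : IsSU11 g) :
    moeb g (-1) = -(g 0 0 - g 0 1) / conj (g 0 0 - g 0 1) := by
  rw [moeb, hg.1, hg.2.1, map_sub]
  congr 1 <;> ring

theorem IsSU11.moeb_zero (hg : IsSU11 g) :
    moeb g 0 = ((g 0 0 + g 0 1) - (g 0 0 - g 0 1)) /
      (conj (g 0 0 + g 0 1) + conj (g 0 0 - g 0 1)) := by
  rw [moeb, hg.1, hg.2.1, map_sub, map_add, ← mul_div_mul_left _ _ (two_ne_zero (α := ℂ))]
  congr 1 <;> ring

theorem flow_row_add (g : Matrix (Fin 2) (Fin 2) ℂ) (τ u : ℝ) :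
    (g * Amat τ * Nmat u) 0 0 + (g * Amat τ * Nmat u) 0 1 =
      (Real.exp (τ / 2) : ℂ) * (g 0 0 + g 0 1) := by
  rw [← Real.cosh_add_sinh]
  simp only [Amat, Nmat, Matrix.mul_apply, Fin.sum_univ_two, Matrix.of_apply, Matrix.cons_val',
    Matrix.cons_val_zero, Matrix.cons_val_one, Matrix.cons_val_fin_one]
  push_cast
  ring

theorem flow_row_sub (g : Matrix (Fin 2) (Fin 2) ℂ) (τ u : ℝ) :
    (g * Amat τ * Nmat u) 0 0 - (g * Amat τ * Nmat u) 0 1 =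
      (Real.exp (-(τ / 2)) : ℂ) * (g 0 0 - g 0 1) +
        u * Complex.I * ((Real.exp (τ / 2) : ℂ) * (g 0 0 + g 0 1)) := by
  rw [← Real.cosh_add_sinh (τ / 2), ← Real.cosh_sub_sinh]
  simp only [Amat, Nmat, Matrix.mul_apply, Fin.sum_univ_two, Matrix.of_apply, Matrix.cons_val',
    Matrix.cons_val_zero, Matrix.cons_val_one, Matrix.cons_val_fin_one]
  push_cast
  ring

theorem IsSU11.flow (hg : IsSU11 g) (τ u : ℝ) : IsSU11 (g * Amat τ * Nmat u) :=
  (hg.mul (isSU11_Amat τ)).mul (isSU11_Nmat u)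

theorem moeb_flow_one (hg : IsSU11 g) (τ u : ℝ) : moeb (g * Amat τ * Nmat u) 1 = moeb g 1 := by
  have he : (Real.exp (τ / 2) : ℂ) ≠ 0 := by exact_mod_cast (Real.exp_pos _).ne'
  rw [(hg.flow τ u).moeb_one, hg.moeb_one, flow_row_add, map_mul, Complex.conj_ofReal,
    mul_div_mul_left _ _ he]

theorem moeb_flow_zero (hg : IsSU11 g) (τ u : ℝ) :
    moeb (g * Amat τ * Nmat u) 0 =
      discPoint (g 0 0 + g 0 1) (g 0 0 - g 0 1) (halfPlanePoint ⟨τ, u⟩) := by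
  have he : (Real.exp (-(τ / 2)) : ℂ) ≠ 0 := by exact_mod_cast (Real.exp_pos _).ne'
  have hexp : (Real.exp (τ / 2) : ℂ) = (Real.exp (-(τ / 2)) : ℂ) * (Real.exp τ : ℂ) := by
    norm_cast
    rw [← Real.exp_add]
    congr 1
    ring
  rw [(hg.flow τ u).moeb_zero, flow_row_add, flow_row_sub, discPoint,
    ← mul_div_mul_left ((g 0 0 + g 0 1) * halfPlanePoint ⟨τ, u⟩ - (g 0 0 - g 0 1)) _ he]
  simp only [halfPlanePoint, map_add, map_mul, Complex.conj_ofReal, Complex.conj_I, hexp]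
  congr 1 <;> ring

end Frames

section PattersonSullivan

variable {g : Matrix (Fin 2) (Fin 2) ℂ}

theorem continuous_flow (g : Matrix (Fin 2) (Fin 2) ℂ) :
    Continuous fun x : ℝ × ℝ => g * Amat x.1 * Nmat x.2 := by
  have hA : Continuous fun x : ℝ × ℝ => Amat x.1 := by
    refine continuous_matrix fun i j => ?_
    fin_cases i <;> fin_cases j <;> simp only [Amat] <;> simp <;> fun_prop
  have hN : Continuous fun x : ℝ × ℝ => Nmat x.2 := by
    refine continuous_matrix fun i j => ?_
    fin_cases i <;> fin_cases j <;> simp only [Nmat] <;> simp <;> fun_prop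
  exact (continuous_const.matrix_mul hA).matrix_mul hN

/-- The horocyclic parametrization of `SU(1,1)` by `(τ, u)` is proper. -/
theorem hasCompactSupport_comp_flow (hg : IsSU11 g) {a : Matrix (Fin 2) (Fin 2) ℂ → ℂ}
    (hcs : HasCompactSupport a) :
    HasCompactSupport fun x : ℝ × ℝ => a (g * Amat x.1 * Nmat x.2) := by
  obtain ⟨C₁, hC₁⟩ := hcs.isCompact.exists_bound_of_continuousOn
    (f := fun m => m 0 0 + m 0 1) (by fun_prop)
  obtain ⟨C₂, hC₂⟩ := hcs.isCompact.exists_bound_of_continuousOn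
    (f := fun m => m 0 0 - m 0 1) (by fun_prop)
  have hpq := hg.row_relation
  set p := g 0 0 + g 0 1 with hp
  set q := g 0 0 - g 0 1 with hq
  have hp0 : 0 < ‖p‖ := norm_pos_iff.2 (left_ne_zero hpq)
  have hre : (conj p * q).re = 1 := by
    have := congrArg Complex.re hpq
    simp at this ⊢
    linarith
  set B := ‖p‖ * C₂ with hB
  refine HasCompactSupport.intro (K := Set.Icc (-(2 * B)) (2 * C₁ / ‖p‖) ×ˢ
    Set.Icc (-((C₂ + B * ‖q‖) * B / ‖p‖)) ((C₂ + B * ‖q‖) * B / ‖p‖))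
    (isCompact_Icc.prod isCompact_Icc) fun x hx => ?_
  by_contra hax
  apply hx
  obtain ⟨τ, u⟩ := x
  have hmem := subset_tsupport a hax
  have h1 := hC₁ _ hmem
  have h2 := hC₂ _ hmem
  simp only [flow_row_add, flow_row_sub] at h1 h2
  rw [← hp] at h1 h2
  rw [← hq] at h2
  set E := Real.exp (τ / 2) with hE
  set E' := Real.exp (-(τ / 2)) with hE'
  have hEpos : 0 < E := Real.exp_pos _
  have hE'pos : 0 < E' := Real.exp_pos _
  have hEE' : E * E' = 1 := by rw [hE, hE', ← Real.exp_add]; simp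
  have hEp : E * ‖p‖ ≤ C₁ := by
    rwa [norm_mul, Complex.norm_real, Real.norm_of_nonneg hEpos.le] at h1
  have hE'B : E' ≤ B := by
    have hval : (conj p * ((E' : ℂ) * q + u * Complex.I * ((E : ℂ) * p))).re = E' := by
      have : conj p * ((E' : ℂ) * q + u * Complex.I * ((E : ℂ) * p)) =
          (E' : ℂ) * (conj p * q) + ((u * E * ‖p‖ ^ 2 : ℝ) : ℂ) * Complex.I := by
        push_cast
        rw [← Complex.mul_conj']
        ring
      rw [this, Complex.add_re, Complex.re_ofReal_mul, hre, Complex.re_ofReal_mul]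
      simp
    calc E' = _ := hval.symm
      _ ≤ ‖conj p * ((E' : ℂ) * q + u * Complex.I * ((E : ℂ) * p))‖ := Complex.re_le_norm _
      _ ≤ B := by
        rw [norm_mul, Complex.norm_conj]
        exact mul_le_mul_of_nonneg_left h2 hp0.le
  have huE : |u| * E * ‖p‖ ≤ C₂ + B * ‖q‖ := by
    have hval : ‖(u : ℂ) * Complex.I * ((E : ℂ) * p)‖ = |u| * E * ‖p‖ := by
      simp only [norm_mul, Complex.norm_real, Complex.norm_I, Real.norm_eq_abs, abs_of_pos hEpos]
      ring
    have hq' : ‖(E' : ℂ) * q‖ = E' * ‖q‖ := by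
      rw [norm_mul, Complex.norm_real, Real.norm_of_nonneg hE'pos.le]
    have h3 := norm_sub_le ((E' : ℂ) * q + u * Complex.I * ((E : ℂ) * p)) ((E' : ℂ) * q)
    rw [add_sub_cancel_left, hval, hq'] at h3
    nlinarith [norm_nonneg q, mul_le_mul_of_nonneg_right hE'B (norm_nonneg q)]
  have hu : |u| ≤ (C₂ + B * ‖q‖) * B / ‖p‖ := by
    rw [le_div_iff₀ hp0]
    calc |u| * ‖p‖ = |u| * E * ‖p‖ * E' := by linear_combination -(|u| * ‖p‖) * hEE'
      _ ≤ (C₂ + B * ‖q‖) * B := mul_le_mul huE hE'B hE'pos.le (le_trans (by positivity) huE)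
  refine ⟨⟨?_, ?_⟩, abs_le.1 hu⟩
  · have := Real.add_one_le_exp (-(τ / 2))
    simp only
    linarith
  · have := Real.add_one_le_exp (τ / 2)
    simp only
    rw [le_div_iff₀ hp0]
    nlinarith

theorem integrable_horocyclic (hg : IsSU11 g) {a : Matrix (Fin 2) (Fin 2) ℂ → ℂ}
    (hcont : Continuous a) (hcs : HasCompactSupport a) (r r' : ℝ) :
    Integrable (fun x : ℝ × ℝ =>
      a (g * Amat x.1 * Nmat x.2) *
        ((1 + x.2 ^ 2 : ℝ) : ℂ) ^ (-((1 : ℂ) / 2) - Complex.I * (r' : ℂ)) *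
        Complex.exp (Complex.I * ((r : ℂ) - (r' : ℂ)) * (x.1 : ℂ))) := by
  refine Continuous.integrable_of_hasCompactSupport ?_
    ((hasCompactSupport_comp_flow hg hcs).mul_right.mul_right)
  refine ((hcont.comp (continuous_flow g)).mul (Continuous.cpow (by fun_prop) continuous_const
    fun x => Complex.ofReal_mem_slitPlane.2 (by positivity))).mul (by fun_prop)

/-- The product of Poisson kernels in horocyclic coordinates. -/
theorem Pk_cpow_mul_Pk_cpow {p q : ℂ} (hpq : p * conj q + conj p * q = 2) (hn : ‖p‖ = ‖q‖)
    (r r' τ u : ℝ) :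
    (Pk (discPoint p q (halfPlanePoint ⟨τ, u⟩)) (p / conj p) : ℂ) ^
        ((1 : ℂ) / 2 + Complex.I * (r : ℂ)) *
      (Pk (discPoint p q (halfPlanePoint ⟨τ, u⟩)) (-q / conj q) : ℂ) ^
        ((1 : ℂ) / 2 + Complex.I * (r' : ℂ)) =
    ((‖p‖ ^ 2 : ℝ) : ℂ) ^ (1 + Complex.I * ((r : ℂ) + (r' : ℂ))) *
      (((1 + u ^ 2 : ℝ) : ℂ) ^ (-((1 : ℂ) / 2) - Complex.I * (r' : ℂ)) *
        Complex.exp (Complex.I * ((r : ℂ) - (r' : ℂ)) * (τ : ℂ))) := by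
  have hs : 0 < (halfPlanePoint ⟨τ, u⟩).re := by rw [halfPlanePoint_re]; exact Real.exp_pos _
  have hq0 : 0 < ‖q‖ := norm_pos_iff.2 (right_ne_zero hpq)
  have he := Real.exp_pos τ
  rw [Pk_discPoint_forward hpq hs, Pk_discPoint_backward hpq hs, normSq_halfPlanePoint,
    halfPlanePoint_re, hn]
  have hc : 0 < ‖q‖ ^ 2 := by positivity
  have hu : 0 < 1 + u ^ 2 := by positivity
  have hback : Real.exp τ * ‖q‖ ^ 2 / (Real.exp τ ^ 2 * (1 + u ^ 2)) =
      ‖q‖ ^ 2 / (Real.exp τ * (1 + u ^ 2)) := by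
    field_simp
  dsimp only
  rw [hback, cpow_eq_exp_log (by positivity), cpow_eq_exp_log (by positivity),
    cpow_eq_exp_log hc, cpow_eq_exp_log hu, ← Complex.exp_add, ← Complex.exp_add,
    ← Complex.exp_add, Real.log_mul he.ne' hc.ne', Real.log_div hc.ne' (by positivity),
    Real.log_mul he.ne' hu.ne', Real.log_exp]
  congr 1
  push_cast
  ring

/-- For a frame, the two row combinations have the same norm, which determines the
chordal distance of the endpoints. -/
theorem frameFor.norm_relations {b b' : ℂ} (h : frameFor g b' b) :
    ‖g 0 0 + g 0 1‖ = ‖g 0 0 - g 0 1‖ ∧ ‖b - b'‖ = 2 / ‖g 0 0 + g 0 1‖ ^ 2 := by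
  obtain ⟨hg, rfl, rfl, hd⟩ := h
  have hpq := hg.row_relation
  rw [hg.moeb_zero, hg.moeb_one, hg.moeb_neg_one] at hd
  rw [hg.moeb_one, hg.moeb_neg_one]
  set p := g 0 0 + g 0 1
  set q := g 0 0 - g 0 1
  have hp := left_ne_zero hpq
  have hq := right_ne_zero hpq
  have hp' : conj p ≠ 0 := by simpa using hp
  have hq' : conj q ≠ 0 := by simpa using hq
  have hD : conj p + conj q ≠ 0 := by simpa using den_ne_zero (s := 1) hpq (by simp)
  have h1 : (p - q) / (conj p + conj q) - p / conj p = -2 / ((conj p + conj q) * conj p) := by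
    rw [div_sub_div _ _ hD hp']
    congr 1
    linear_combination -hpq
  have h2 : (p - q) / (conj p + conj q) - -q / conj q = 2 / ((conj p + conj q) * conj q) := by
    rw [div_sub_div _ _ hD hq']
    congr 1
    linear_combination hpq
  have h3 : p / conj p - -q / conj q = 2 / (conj p * conj q) := by
    rw [div_sub_div _ _ hp' hq']
    congr 1
    linear_combination hpq
  have hnp : ‖p‖ ≠ 0 := norm_ne_zero_iff.2 hp
  have hnq : ‖q‖ ≠ 0 := norm_ne_zero_iff.2 hq
  have hnD : ‖conj p + conj q‖ ≠ 0 := norm_ne_zero_iff.2 hD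
  have hn : ‖p‖ = ‖q‖ := by
    rw [h1, h2, norm_div, norm_div, norm_mul, norm_mul, norm_neg, Complex.norm_conj,
      Complex.norm_conj, Complex.norm_ofNat, div_eq_div_iff (by positivity) (by positivity)] at hd
    have hd' := mul_left_cancel₀ two_ne_zero hd
    exact (mul_left_cancel₀ hnD hd').symm
  refine ⟨hn, ?_⟩
  rw [h3, norm_div, norm_mul, Complex.norm_conj, Complex.norm_conj, ← hn, Complex.norm_ofNat, sq]

end PattersonSullivan

/-- The Patterson–Sullivan distribution `PS_{(ir,b),(−ir',b')}` applied to the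
horocyclic average `L_{ir'} a` equals `2^{−(1+i(r+r'))}` times the Wigner
distribution `W_{(ir,b),(−ir',b')}` applied to `a`. -/
theorem PS_of_horocyclic_average_eq_wigner
    (a : Matrix (Fin 2) (Fin 2) ℂ → ℂ)
    (hcont : Continuous a) (hcs : HasCompactSupport a)
    (hsym : ∀ g : Matrix (Fin 2) (Fin 2) ℂ, IsSU11 g → a (-g) = a g)
    (b b' : ℂ) (hb : ‖b‖ = 1) (hb' : ‖b'‖ = 1) (hne : b ≠ b')
    (g₀ : Matrix (Fin 2) (Fin 2) ℂ) (hg₀ : frameFor g₀ b' b)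
    (r r' : ℝ) (A : ℂ → ℂ)
    (hA : ∀ g : Matrix (Fin 2) (Fin 2) ℂ, IsSU11 g → moeb g 1 = b →
      A (moeb g 0) = a g) :
    Integrable (fun p : ℝ × ℝ =>
      a (g₀ * Amat p.1 * Nmat p.2) *
        ((1 + p.2 ^ 2 : ℝ) : ℂ) ^ (-((1 : ℂ) / 2) - Complex.I * (r' : ℂ)) *
        Complex.exp (Complex.I * ((r : ℂ) - (r' : ℂ)) * (p.1 : ℂ))) ∧
    Integrable (fun z : ℂ =>
      A z * (Pk z b : ℂ) ^ ((1 : ℂ) / 2 + Complex.I * (r : ℂ)) *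
        (Pk z b' : ℂ) ^ ((1 : ℂ) / 2 + Complex.I * (r' : ℂ))) hypVol ∧
    (‖b - b'‖ : ℂ) ^ (-(1 + Complex.I * ((r : ℂ) + (r' : ℂ)))) *
      (∫ τ : ℝ, ∫ u : ℝ,
        a (g₀ * Amat τ * Nmat u) *
          ((1 + u ^ 2 : ℝ) : ℂ) ^ (-((1 : ℂ) / 2) - Complex.I * (r' : ℂ)) *
          Complex.exp (Complex.I * ((r : ℂ) - (r' : ℂ)) * (τ : ℂ))) =
    (2 : ℂ) ^ (-(1 + Complex.I * ((r : ℂ) + (r' : ℂ)))) *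
      ∫ z, A z * (Pk z b : ℂ) ^ ((1 : ℂ) / 2 + Complex.I * (r : ℂ)) *
        (Pk z b' : ℂ) ^ ((1 : ℂ) / 2 + Complex.I * (r' : ℂ)) ∂hypVol := by
  obtain ⟨hn, hdist⟩ := hg₀.norm_relations
  obtain ⟨hg, hb1, hb2, -⟩ := hg₀
  have hpq := hg.row_relation
  have hPS := integrable_horocyclic hg hcont hcs r r'
  have hb1' := hg.moeb_one.symm.trans hb1
  have hb2' := hg.moeb_neg_one.symm.trans hb2
  obtain ⟨hint, hval⟩ := hypVol_horocyclic hpq fun z =>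
    A z * (Pk z b : ℂ) ^ ((1 : ℂ) / 2 + Complex.I * (r : ℂ)) *
      (Pk z b' : ℂ) ^ ((1 : ℂ) / 2 + Complex.I * (r' : ℂ))
  have hpt := fun x : ℝ × ℝ =>
    Pk_cpow_mul_Pk_cpow hpq hn r r' x.1 x.2
  have hAx : ∀ x : ℝ × ℝ, A (discPoint (g₀ 0 0 + g₀ 0 1) (g₀ 0 0 - g₀ 0 1)
      (halfPlanePoint ⟨x.1, x.2⟩)) = a (g₀ * Amat x.1 * Nmat x.2) := fun x => by
    rw [← moeb_flow_zero hg]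
    exact hA _ (hg.flow _ _) ((moeb_flow_one hg _ _).trans hb1)
  rw [hb1', hb2'] at hpt
  simp only [mul_assoc (A _), hAx] at hint hval
  simp only [mul_assoc (a _), hpt,
    mul_left_comm (a _) (((‖g₀ 0 0 + g₀ 0 1‖ ^ 2 : ℝ) : ℂ) ^
      (1 + Complex.I * ((r : ℂ) + (r' : ℂ))))] at hint hval
  simp only [mul_assoc (a _)] at hPS
  refine ⟨by simpa only [mul_assoc] using hPS,
    by simpa only [mul_assoc] using hint.2 (hPS.const_mul _), ?_⟩
  simp only [mul_assoc (a _), mul_assoc (A _)]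
  rw [hval, integral_const_mul, ← mul_assoc,
    ← integral_prod (fun x : ℝ × ℝ => a (g₀ * Amat x.1 * Nmat x.2) *
      (((1 + x.2 ^ 2 : ℝ) : ℂ) ^ (-((1 : ℂ) / 2) - Complex.I * (r' : ℂ)) *
        Complex.exp (Complex.I * ((r : ℂ) - (r' : ℂ)) * (x.1 : ℂ)))) hPS]
  congr 1
  have hc : 0 < ‖g₀ 0 0 + g₀ 0 1‖ ^ 2 := pow_pos (norm_pos_iff.2 (left_ne_zero hpq)) 2
  have h2 := cpow_eq_exp_log two_pos (-(1 + Complex.I * ((r : ℂ) + (r' : ℂ))))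
  rw [Complex.ofReal_ofNat] at h2
  rw [hdist, cpow_eq_exp_log (by positivity), h2, cpow_eq_exp_log hc, ← Complex.exp_add,
    Real.log_div two_ne_zero hc.ne']
  congr 1
  push_cast
  ring
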